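/- Let d ≥ 2 and let K, L ⊆ ℝ^d be closed convex sets with nonempty interior, with K ≠ ℝ^d and L ≠ ℝ^d, both satisfying condition (A), and such that at least one of K and L has an extreme point. Then the following are equivalent: (1) for all orientation-preserving surjective isometries φ, ψ of ℝ^d, if φ(K) ∩ ψ(L) has nonempty interior then φ(K) ∩ ψ(L) is centrally symmetric; (2) K and L are congruent balls, i.e. there exist r > 0 and points c, c′ with K the closed ball of radius r about c and L the closed ball of radius r about c′. -/

import Mathlib

open Metric Set

noncomputable section

/-- Euclidean `d`-space. -/
abbrev Euc (d : ℕ) := EuclideanSpace ℝ (Fin d)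

/-- A set is centrally symmetric if some point reflection `x ↦ 2c − x` maps it onto itself. -/
def CentrallySymmetric {d : ℕ} (S : Set (Euc d)) : Prop :=
  ∃ c : Euc d, (fun x => (2 : ℝ) • c - x) '' S = S

/-- An affine isometry (congruence) of Euclidean space is orientation preserving if its
linear part has determinant `1`. -/
def OrientationPreserving {d : ℕ} (φ : Euc d ≃ᵃⁱ[ℝ] Euc d) : Prop :=
  LinearMap.det (φ.linearIsometryEquiv.toLinearEquiv : Euc d →ₗ[ℝ] Euc d) = 1

/-- Condition (A): every frontier point of `K` lies on the boundary of some ball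
contained in `K`. -/
def CondA {d : ℕ} (K : Set (Euc d)) : Prop :=
  ∀ x ∈ frontier K, ∃ ε₁ : ℝ, 0 < ε₁ ∧ ∃ c : Euc d, dist x c = ε₁ ∧ closedBall c ε₁ ⊆ K

/-- `K` has an extreme point: a point of `K` not lying in the open segment joining two
distinct points of `K`. -/
def HasExtremePoint {d : ℕ} (K : Set (Euc d)) : Prop :=
  ∃ x ∈ K, ∀ y ∈ K, ∀ z ∈ K, y ≠ z → x ∉ openSegment ℝ y z

section SupportingHyperplanes

variable {E : Type*} [NormedAddCommGroup E] [InnerProductSpace ℝ E]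

/-- `n` is a unit outer normal of `K` at the point `x` of `K`. -/
def IsOuterNormal (K : Set E) (x n : E) : Prop :=
  x ∈ K ∧ ‖n‖ = 1 ∧ ∀ z ∈ K, inner ℝ (z - x) n ≤ 0

/-- The hyperplane through `x` orthogonal to `n` meets `K` at most in `x`. -/
def ExposedAt (K : Set E) (x n : E) : Prop :=
  ∀ z ∈ K, inner ℝ (z - x) n = 0 → z = x

/-- The ball of radius `r` touching the hyperplane with outer normal `n` at `x` from
inside lies in `K`. -/
def InnerBall (K : Set E) (r : ℝ) (x n : E) : Prop :=
  closedBall (x - r • n) r ⊆ K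

/-- Near `x`, the boundary points `x'` of `K` with normals `n'` have the same center of
curvature `x' - l • n'`. -/
def LocallySpherical (K : Set E) (x n : E) (l : ℝ) : Prop :=
  ∃ δ > 0, ∀ x' n', IsOuterNormal K x' n' → ‖x' - x‖ < δ → x' - x = l • (n' - n)

/-- The isometry `x + z ↦ y + S z` maps `K` near `x` onto `L` near `y`. -/
def LocallyCongruent (K : Set E) (x : E) (L : Set E) (y : E) (S : E ≃ₗᵢ[ℝ] E) (r : ℝ) : Prop :=
  ∀ z, ‖z‖ ≤ r → (x + z ∈ K ↔ y + S z ∈ L)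

theorem LocallyCongruent.symm {K L : Set E} {x y : E} {S : E ≃ₗᵢ[ℝ] E} {r : ℝ}
    (h : LocallyCongruent K x L y S r) : LocallyCongruent L y K x S.symm r := by
  intro z hz
  have := h (S.symm z) (by simpa using hz)
  simpa using this.symm

theorem exists_small_smul (v : E) {r : ℝ} (hr : 0 < r) :
    ∃ t : ℝ, 0 < t ∧ t ≤ 1 ∧ ‖t • v‖ < r := by
  refine ⟨min 1 (r / (2 * (‖v‖ + 1))), by positivity, min_le_left _ _, ?_⟩
  rw [norm_smul, Real.norm_of_nonneg (by positivity)]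
  have h1 : min 1 (r / (2 * (‖v‖ + 1))) ≤ r / (2 * (‖v‖ + 1)) := min_le_right _ _
  calc _ ≤ r / (2 * (‖v‖ + 1)) * (‖v‖ + 1) := by gcongr; linarith
    _ = r / 2 := by field_simp
    _ < r := by linarith

theorem add_smul_sub_mem {K : Set E} (hK : Convex ℝ K) {x z : E} (hx : x ∈ K) (hz : z ∈ K)
    {t : ℝ} (h0 : 0 < t) (h1 : t ≤ 1) : x + t • (z - x) ∈ K :=
  hK.add_smul_sub_mem hx hz ⟨h0.le, h1⟩

/-- Outer normals are transported by local congruences. -/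
theorem IsOuterNormal.map {K L : Set E} {x y w m : E} {S : E ≃ₗᵢ[ℝ] E} {r : ℝ}
    (hL : Convex ℝ L) (h : LocallyCongruent K x L y S r) (hw : ‖w‖ < r)
    (hm : IsOuterNormal K (x + w) m) : IsOuterNormal L (y + S w) (S m) := by
  obtain ⟨h1, h2, h3⟩ := hm
  have hyL := (h w hw.le).1 h1
  refine ⟨hyL, by simpa using h2, fun v hv => ?_⟩
  obtain ⟨t, ht, ht1, htr⟩ := exists_small_smul (v - (y + S w)) (sub_pos.2 hw)
  have hmem := add_smul_sub_mem hL hyL hv ht ht1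
  set q := S.symm (t • (v - (y + S w))) with hq
  have hSq : S q = t • (v - (y + S w)) := by simp [hq]
  have hn : ‖q‖ < r - ‖w‖ := by rw [hq, LinearIsometryEquiv.norm_map]; exact htr
  have := (h (w + q) ((norm_add_le _ _).trans (by linarith))).2 (by
    rw [map_add, hSq, ← add_assoc]; exact hmem)
  have h4 := h3 _ this
  rw [show x + (w + q) - (x + w) = q by abel, ← S.inner_map_map, hSq, inner_smul_left] at h4
  simp only [conj_trivial] at h4
  by_contra! hcon
  have := mul_pos ht hcon
  linarith

theorem ExposedAt.map {K L : Set E} {x y m : E} {S : E ≃ₗᵢ[ℝ] E} {r : ℝ} (hr : 0 < r)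
    (hL : Convex ℝ L) (h : LocallyCongruent K x L y S r) (hx : x ∈ K)
    (hm : ExposedAt K x m) : ExposedAt L y (S m) := by
  intro v hv hv0
  have hyL : y ∈ L := by simpa using (h 0 (by simpa using hr.le)).1 (by simpa using hx)
  obtain ⟨t, ht, ht1, htr⟩ := exists_small_smul (v - y) hr
  have hmem := add_smul_sub_mem hL hyL hv ht ht1
  set q := S.symm (t • (v - y)) with hq
  have hSq : S q = t • (v - y) := by simp [hq]
  have hn : ‖q‖ ≤ r := by rw [hq, LinearIsometryEquiv.norm_map]; exact htr.le
  have hqK := (h q hn).2 (by rw [hSq]; exact hmem)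
  have h4 := hm _ hqK (by
    rw [add_sub_cancel_left, ← S.inner_map_map, hSq, inner_smul_left, hv0, mul_zero])
  have h5 : t • (v - y) = 0 := by rw [← hSq]; simpa using h4
  rcases smul_eq_zero.1 h5 with h6 | h6
  · exact absurd h6 ht.ne'
  · exact sub_eq_zero.1 h6

theorem LocallySpherical.map {K L : Set E} {x y n : E} {S : E ≃ₗᵢ[ℝ] E} {r l : ℝ} (hr : 0 < r)
    (hK : Convex ℝ K) (h : LocallyCongruent K x L y S r)
    (hm : LocallySpherical K x n l) : LocallySpherical L y (S n) l := by
  obtain ⟨δ, hδ, H⟩ := hm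
  refine ⟨min δ r, lt_min hδ hr, fun y' n' hn' hd => ?_⟩
  have h1 := IsOuterNormal.map (w := y' - y) (m := n') hK h.symm
    (hd.trans_le (min_le_right _ _)) (by simpa using hn')
  have h2 := H _ _ h1 (by
    rw [add_sub_cancel_left, LinearIsometryEquiv.norm_map]
    exact hd.trans_le (min_le_left _ _))
  have h3 := congrArg S h2
  simpa using h3

/-- A ball in `K` touching the boundary at `x` has its center on the normal at `x`. -/
theorem IsOuterNormal.eq_of_ball {K : Set E} {x c n : E} {ε : ℝ} (hn : IsOuterNormal K x n)
    (hε : 0 < ε) (hc : dist x c = ε) (hb : closedBall c ε ⊆ K) : x - c = ε • n := by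
  obtain ⟨-, h1, h2⟩ := hn
  have h3 := h2 (c + ε • n) (hb (by simp [norm_smul, h1, abs_of_pos hε]))
  rw [dist_eq_norm] at hc
  have h4 : inner ℝ (x - c) n ≥ ε := by
    have : c + ε • n - x = ε • n - (x - c) := by abel
    rw [this, inner_sub_left, inner_smul_left, real_inner_self_eq_norm_sq, h1] at h3
    simp only [conj_trivial] at h3
    linarith
  have h5 : ‖x - c - ε • n‖ ^ 2 ≤ 0 := by
    rw [norm_sub_sq_real, inner_smul_right, norm_smul, h1, hc, Real.norm_of_nonneg hε.le]
    nlinarith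
  exact sub_eq_zero.1 (norm_eq_zero.1 (by nlinarith [norm_nonneg (x - c - ε • n)]))

theorem InnerBall.mono {K : Set E} {r s : ℝ} {x n : E} (hn : ‖n‖ = 1) (h : InnerBall K r x n)
    (hsr : s ≤ r) : InnerBall K s x n := by
  refine (closedBall_subset_closedBall' ?_).trans h
  rw [dist_eq_norm, show x - s • n - (x - r • n) = (r - s) • n by rw [sub_smul]; abel,
    norm_smul, hn, Real.norm_of_nonneg (by linarith)]
  linarith

/-- An exposed point is the only point with its normal. -/
theorem ExposedAt.eq_of_normal {K : Set E} {x y n : E} (he : ExposedAt K x n)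
    (hx : IsOuterNormal K x n) (hy : IsOuterNormal K y n) : y = x := by
  refine he y hy.1 (le_antisymm (hx.2.2 y hy.1) ?_)
  have := hy.2.2 x hx.1
  rw [← neg_sub, inner_neg_left] at this
  linarith

theorem norm_sq_smul_add_smul {n f : E} (hn : ‖n‖ = 1) (hf : ‖f‖ = 1) (hfn : inner ℝ f n = 0)
    (a b : ℝ) : ‖a • f + b • n‖ ^ 2 = a ^ 2 + b ^ 2 := by
  rw [norm_add_sq_real, inner_smul_left, inner_smul_right, hfn, norm_smul, norm_smul, hn, hf]
  simp

theorem IsOuterNormal.mem_frontier {K : Set E} {x n : E} (h : IsOuterNormal K x n) :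
    x ∈ frontier K := by
  refine ⟨subset_closure h.1, fun hi => ?_⟩
  obtain ⟨ε, hε, hb⟩ := Metric.mem_nhds_iff.1 (mem_interior_iff_mem_nhds.1 hi)
  have := h.2.2 (x + (ε / 2) • n) (hb (by simp [norm_smul, h.2.1, abs_of_pos hε, hε]))
  rw [add_sub_cancel_left, inner_smul_left, real_inner_self_eq_norm_sq, h.2.1] at this
  simp only [conj_trivial] at this
  linarith

theorem exists_mem_frontier_segment {K : Set E} {a b : E} (ha : a ∈ K) (hb : b ∉ K) :
    ∃ t ∈ Icc (0 : ℝ) 1, a + t • (b - a) ∈ frontier K := by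
  have hc : Continuous fun t : ℝ => a + t • (b - a) := by fun_prop
  have hp : IsPreconnected ((fun t : ℝ => a + t • (b - a)) '' Icc 0 1) :=
    isPreconnected_Icc.image _ hc.continuousOn
  by_contra! hcon
  have ha' : a ∈ interior K := by
    by_contra h
    exact hcon 0 (by simp) (by simpa using ⟨subset_closure ha, h⟩)
  have := hp.subset_of_closure_inter_subset isOpen_interior ⟨a, ⟨0, by simp, by simp⟩, ha'⟩ (by
    rintro z ⟨hz1, t, ht, rfl⟩
    by_contra h
    exact hcon t ht ⟨closure_mono interior_subset hz1, h⟩)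
  exact hb (interior_subset (this ⟨1, by simp, by simp⟩))

theorem exists_isOuterNormal [CompleteSpace E] {K : Set E} (hK : Convex ℝ K) (hcl : IsClosed K)
    (hi : (interior K).Nonempty) {x : E} (hx : x ∈ frontier K) : ∃ n, IsOuterNormal K x n := by
  obtain ⟨f, hf0, hf⟩ := geometric_hahn_banach_of_nonempty_interior_point hK hx.2 hi
  obtain ⟨v, rfl⟩ := (InnerProductSpace.toDual ℝ E).surjective f
  have hv : v ≠ 0 := fun h => hf0 (by simp [h])
  refine ⟨‖v‖⁻¹ • v, hcl.frontier_subset hx, norm_smul_inv_norm hv, fun z hz => ?_⟩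
  have := hf z hz
  simp only [InnerProductSpace.toDual_apply_apply] at this
  rw [inner_smul_right, inner_sub_left, real_inner_comm, real_inner_comm v x]
  exact mul_nonpos_of_nonneg_of_nonpos (by positivity) (by linarith)

/-- Next to an exposed boundary point with an inner ball, there are boundary points in every
tangential direction. -/
theorem exists_nearby_normal [CompleteSpace E] {K : Set E} (hK : Convex ℝ K) (hcl : IsClosed K)
    (hi : (interior K).Nonempty) {x n f : E} {r η : ℝ} (hn : IsOuterNormal K x n)
    (he : ExposedAt K x n) (hb : InnerBall K r x n) (hf : ‖f‖ = 1) (hfn : inner ℝ f n = 0)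
    (hη : 0 < η) (hηr : η ≤ r) :
    ∃ s m, 0 ≤ s ∧ s ≤ η ^ 2 / r ∧ IsOuterNormal K (x + η • f - s • n) m := by
  have hr : 0 < r := hη.trans_le hηr
  have ha : x + η • f - (η ^ 2 / r) • n ∈ K := by
    apply hb
    rw [mem_closedBall, dist_eq_norm, show x + η • f - (η ^ 2 / r) • n - (x - r • n)
      = η • f + (r - η ^ 2 / r) • n by rw [sub_smul]; abel]
    refine abs_le_of_sq_le_sq' ?_ hr.le |>.2
    rw [norm_sq_smul_add_smul hn.2.1 hf hfn]
    have h1 : r * (η ^ 2 / r) = η ^ 2 := by field_simp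
    have h2 : η ^ 2 / r ≤ r := by rw [div_le_iff₀ hr]; nlinarith
    nlinarith [mul_nonneg (sub_nonneg.2 h2) (by positivity : 0 ≤ η ^ 2 / r)]
  have hb' : x + η • f ∉ K := by
    intro h
    have := he _ h (by rw [add_sub_cancel_left, inner_smul_left, hfn, mul_zero])
    have h0 : η • f = 0 := by simpa using this
    rcases smul_eq_zero.1 h0 with h | h
    · exact hη.ne' h
    · simp [h] at hf
  obtain ⟨t, ⟨ht0, ht1⟩, ht⟩ := exists_mem_frontier_segment ha hb'
  obtain ⟨m, hm⟩ := exists_isOuterNormal hK hcl hi ht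
  have h0 : 0 ≤ η ^ 2 / r := by positivity
  refine ⟨(1 - t) * (η ^ 2 / r), m, by nlinarith, by nlinarith, ?_⟩
  convert hm using 1
  module

end SupportingHyperplanes

section ConvexHull

variable {E : Type*} [NormedAddCommGroup E] [NormedSpace ℝ E]

theorem IsCompact.convexJoin_of_isCompact {s t : Set E} (hs : IsCompact s) (ht : IsCompact t) :
    IsCompact (convexJoin ℝ s t) := by
  have h : convexJoin ℝ s t =
      (fun p : (E × E) × ℝ => (1 - p.2) • p.1.1 + p.2 • p.1.2) '' ((s ×ˢ t) ×ˢ Icc 0 1) := by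
    ext z
    simp only [mem_convexJoin, segment_eq_image, mem_image, Prod.exists, mem_prod]
    constructor
    · rintro ⟨a, ha, b, hb, θ, hθ, rfl⟩
      exact ⟨a, b, θ, ⟨⟨ha, hb⟩, hθ⟩, rfl⟩
    · rintro ⟨a, b, θ, ⟨⟨ha, hb⟩, hθ⟩, rfl⟩
      exact ⟨a, ha, b, hb, θ, hθ, rfl⟩
  rw [h]
  exact ((hs.prod ht).prod isCompact_Icc).image (by fun_prop)

/-- Points obtained from `s` by `n` successive joins. -/
def iteratedConvexJoin (s : Set E) : ℕ → Set E
  | 0 => s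
  | n + 1 => convexJoin ℝ s (iteratedConvexJoin s n)

theorem isCompact_iteratedConvexJoin {s : Set E} (hs : IsCompact s) (n : ℕ) :
    IsCompact (iteratedConvexJoin s n) := by
  induction n with
  | zero => exact hs
  | succ n ih => exact hs.convexJoin_of_isCompact ih

theorem iteratedConvexJoin_subset (s : Set E) (n : ℕ) :
    iteratedConvexJoin s n ⊆ convexHull ℝ s := by
  induction n with
  | zero => exact subset_convexHull ℝ s
  | succ n ih => exact convexJoin_subset (subset_convexHull ℝ s) ih (convex_convexHull ℝ s)

theorem convexHull_finset_subset_iteratedConvexJoin {s : Set E} (n : ℕ) :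
    ∀ t : Finset E, (t : Set E) ⊆ s → t.card ≤ n + 1 →
      convexHull ℝ (t : Set E) ⊆ iteratedConvexJoin s n := by
  classical
  induction n with
  | zero =>
    intro t ht hc
    rcases Finset.card_le_one_iff_subset_singleton.1 hc with ⟨a, ha⟩
    rcases Finset.subset_singleton_iff.1 ha with rfl | rfl
    · simp
    · simpa [iteratedConvexJoin] using ht
  | succ n ih =>
    intro t ht hc
    rcases t.eq_empty_or_nonempty with rfl | ⟨a, ha⟩
    · simp
    have has : a ∈ s := ht ha
    rcases (t.erase a).eq_empty_or_nonempty with he | hne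
    · have : t = {a} := by rw [← Finset.insert_erase ha, he]; rfl
      have h1 := ih t ht (by simp [this])
      exact h1.trans (subset_convexJoin_right ⟨a, has⟩)
    · rw [← Finset.insert_erase ha, Finset.coe_insert, convexHull_insert (by exact_mod_cast hne)]
      refine convexJoin_mono (by simpa using has) (ih _ ?_ ?_)
      · exact (Finset.coe_subset.2 (Finset.erase_subset a t)).trans ht
      · rw [Finset.card_erase_of_mem ha]; omega

theorem isCompact_convexHull_of_isCompact [FiniteDimensional ℝ E] {s : Set E} (hs : IsCompact s) :
    IsCompact (convexHull ℝ s) := by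
  have h : convexHull ℝ s = iteratedConvexJoin s (Module.finrank ℝ E) := by
    refine Subset.antisymm ?_ (iteratedConvexJoin_subset s _)
    rw [convexHull_eq_union]
    refine iUnion_subset fun t => iUnion_subset fun ht => iUnion_subset fun hi => ?_
    refine convexHull_finset_subset_iteratedConvexJoin _ t ht ?_
    have h1 := hi.card_le_finrank_succ
    have h2 := Submodule.finrank_le (vectorSpan ℝ (range ((↑) : t → E)))
    simp only [Fintype.card_coe] at h1
    omega
  rw [h]
  exact isCompact_iteratedConvexJoin hs _

end ConvexHull

section ExposedPoints

variable {E : Type*} [NormedAddCommGroup E] [InnerProductSpace ℝ E] [FiniteDimensional ℝ E]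

/-- An extreme point is cut off by a half-space in which the remaining part of the set is
close to the point. -/
theorem exists_small_cap {K : Set E} (hK : Convex ℝ K) (hcl : IsClosed K) {x : E}
    (hx : x ∈ extremePoints ℝ K) :
    ∃ (v : E) (a : ℝ), a < inner ℝ v x ∧ ∀ z ∈ K, a ≤ inner ℝ v z → ‖z - x‖ ≤ 1 := by
  obtain ⟨hxK, hconv⟩ := hK.mem_extremePoints_iff_convex_sdiff.1 hx
  have hS : IsCompact (K ∩ sphere x 1) := (isCompact_sphere x 1).inter_left hcl
  have hsub : convexHull ℝ (K ∩ sphere x 1) ⊆ K \ {x} :=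
    convexHull_min (fun z hz => ⟨hz.1, fun h => by simp [mem_singleton_iff.1 h] at hz⟩) hconv
  obtain ⟨f, a, hfa, hf⟩ := geometric_hahn_banach_closed_point (convex_convexHull ℝ _)
    (isCompact_convexHull_of_isCompact hS).isClosed (fun h => (hsub h).2 rfl)
  obtain ⟨v, rfl⟩ := (InnerProductSpace.toDual ℝ E).surjective f
  simp only [InnerProductSpace.toDual_apply_apply] at hf hfa
  refine ⟨v, a, hf, fun z hz hza => ?_⟩
  by_contra! hcon
  have h0 : 0 < ‖z - x‖ := by linarith
  have hmem := hK.add_smul_sub_mem hxK hz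
    (t := ‖z - x‖⁻¹) ⟨by positivity, inv_le_one_of_one_le₀ hcon.le⟩
  have h1 := hfa _ (subset_convexHull ℝ _ ⟨hmem, by
    rw [mem_sphere, dist_eq_norm, add_sub_cancel_left, norm_smul, norm_inv, norm_norm,
      inv_mul_cancel₀ h0.ne']⟩)
  rw [inner_add_right, inner_smul_right, inner_sub_right] at h1
  have h2 : ‖z - x‖⁻¹ ≤ 1 := inv_le_one_of_one_le₀ hcon.le
  have h3 : 0 < ‖z - x‖⁻¹ := by positivity
  nlinarith

/-- A closed convex set with an extreme point has an exposed point. -/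
theorem exists_exposedAt {K : Set E} (hK : Convex ℝ K) (hcl : IsClosed K)
    {x : E} (hx : x ∈ extremePoints ℝ K) (hK1 : K ≠ {x}) :
    ∃ p u, IsOuterNormal K p u ∧ ExposedAt K p u := by
  obtain ⟨v, a, ha, hcap⟩ := exists_small_cap hK hcl hx
  have hxK : x ∈ K := hx.1
  set C := K ∩ {z | a ≤ inner ℝ v z} with hC
  have hCc : IsCompact C := by
    refine (isCompact_closedBall x 1).of_isClosed_subset
      (hcl.inter (isClosed_le continuous_const (by fun_prop))) fun z hz => ?_
    rw [mem_closedBall, dist_eq_norm]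
    exact hcap z hz.1 hz.2
  set t := 1 / (inner ℝ v x - a) with ht
  have hpos : 0 < inner ℝ v x - a := sub_pos.2 ha
  have ht0 : 0 < t := by positivity
  obtain ⟨p, hpC, hp⟩ := hCc.exists_isMaxOn ⟨x, hxK, ha.le⟩
    (f := fun z => ‖z - (x - t • v)‖) (by fun_prop)
  have hmax : ∀ z ∈ C, ‖z - (x - t • v)‖ ≤ ‖p - (x - t • v)‖ := hp
  set e := p - (x - t • v) with he
  have hpa : a < inner ℝ v p := by
    refine lt_of_le_of_ne hpC.2 fun h => ?_
    have h1 := hmax x ⟨hxK, ha.le⟩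
    have h2 : e = (p - x) + t • v := by rw [he]; abel
    have h3 : ‖e‖ ^ 2 = ‖p - x‖ ^ 2 - 2 + ‖t • v‖ ^ 2 := by
      rw [h2, norm_add_sq_real, inner_smul_right, real_inner_comm, inner_sub_right, ← h]
      have : t * (a - inner ℝ v x) = -1 := by rw [ht]; field_simp; ring
      linarith
    have h4 := hcap p hpC.1 hpC.2
    rw [sub_sub_cancel] at h1
    nlinarith [norm_nonneg (p - x), norm_nonneg e, norm_nonneg (t • v)]
  have hkey : ∀ z ∈ K, ∃ s > 0, 2 * inner ℝ (z - p) e + s * ‖z - p‖ ^ 2 ≤ 0 := by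
    intro z hz
    obtain ⟨s, hs0, hs1, hs⟩ : ∃ s : ℝ, 0 < s ∧ s ≤ 1 ∧ a ≤ inner ℝ v (p + s • (z - p)) := by
      obtain ⟨s, hs0, hs1, hs⟩ := exists_small_smul (inner ℝ v (z - p)) (sub_pos.2 hpa)
      refine ⟨s, hs0, hs1, ?_⟩
      rw [inner_add_right, inner_smul_right]
      rw [smul_eq_mul, Real.norm_eq_abs, abs_lt] at hs
      linarith
    refine ⟨s, hs0, ?_⟩
    have h1 := hmax _ ⟨add_smul_sub_mem hK hpC.1 hz hs0 hs1, hs⟩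
    have h2 : ‖s • (z - p) + e‖ ≤ ‖e‖ := by
      convert h1 using 2
      rw [he]; abel
    have h3 : ‖s • (z - p) + e‖ ^ 2 ≤ ‖e‖ ^ 2 := by gcongr
    rw [norm_add_sq_real, inner_smul_left, norm_smul, Real.norm_of_nonneg hs0.le] at h3
    simp only [conj_trivial] at h3
    have h4 : s * (2 * inner ℝ (z - p) e + s * ‖z - p‖ ^ 2) ≤ 0 := by nlinarith
    by_contra! hcon
    have := mul_pos hs0 hcon
    linarith
  have he0 : e ≠ 0 := by
    intro he0
    apply hK1
    ext z
    rw [mem_singleton_iff]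
    refine ⟨fun hz => ?_, fun hz => hz ▸ hxK⟩
    have hall : ∀ z ∈ K, z = p := by
      intro z hz
      obtain ⟨s, hs, h⟩ := hkey z hz
      rw [he0, inner_zero_right] at h
      have h5 : ‖z - p‖ ^ 2 ≤ 0 := by
        by_contra! hcon
        have := mul_pos hs hcon
        linarith
      exact sub_eq_zero.1 (norm_eq_zero.1 (by nlinarith [norm_nonneg (z - p)]))
    rw [hall z hz, hall x hxK]
  have hep : 0 < ‖e‖ := norm_pos_iff.2 he0
  refine ⟨p, ‖e‖⁻¹ • e, ⟨hpC.1, norm_smul_inv_norm he0, fun z hz => ?_⟩, fun z hz hz0 => ?_⟩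
  · obtain ⟨s, hs, h⟩ := hkey z hz
    rw [inner_smul_right]
    exact mul_nonpos_of_nonneg_of_nonpos (by positivity) (by nlinarith [sq_nonneg ‖z - p‖])
  · obtain ⟨s, hs, h⟩ := hkey z hz
    rw [inner_smul_right] at hz0
    have h6 : inner ℝ (z - p) e = 0 := by
      rcases mul_eq_zero.1 hz0 with h7 | h7
      · exact absurd h7 (by positivity)
      · exact h7
    rw [h6] at h
    have h5 : ‖z - p‖ ^ 2 ≤ 0 := by
      by_contra! hcon
      have := mul_pos hs hcon
      linarith
    exact sub_eq_zero.1 (norm_eq_zero.1 (by nlinarith [norm_nonneg (z - p)]))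

end ExposedPoints

section LocalToGlobal

variable {d : ℕ} {K : Set (Euc d)}

theorem CondA.exists_ball (hA : CondA K) {x n : Euc d} (hn : IsOuterNormal K x n) :
    ∃ r > 0, InnerBall K r x n := by
  obtain ⟨ε, hε, c, hc, hb⟩ := hA x hn.mem_frontier
  refine ⟨ε, hε, ?_⟩
  have := hn.eq_of_ball hε hc hb
  rwa [InnerBall, ← this, sub_sub_cancel]

theorem IsClosed.isClosed_setOf_closedBall_subset (hcl : IsClosed K) (r : ℝ) :
    IsClosed {c | closedBall c r ⊆ K} := by
  have : {c | closedBall c r ⊆ K} = ⋂ v ∈ closedBall (0 : Euc d) r, (fun c => c + v) ⁻¹' K := by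
    ext c
    simp only [mem_ofPred_eq, mem_iInter, mem_preimage]
    refine ⟨fun h v hv => h (by simpa using hv), fun h z hz => ?_⟩
    simpa using h (z - c) (by simpa [dist_eq_norm] using hz)
  rw [this]
  exact isClosed_biInter fun v _ => hcl.preimage (by fun_prop)

/-- On some open piece of the boundary, all inner balls can be chosen of the same radius. -/
theorem CondA.exists_uniform_patch (hA : CondA K) (hK : Convex ℝ K) (hcl : IsClosed K)
    (hi : (interior K).Nonempty) (hne : K ≠ univ) :
    ∃ x n, ∃ r > 0, ∃ δ > 0, IsOuterNormal K x n ∧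
      ∀ x' n', IsOuterNormal K x' n' → ‖x' - x‖ < δ → InnerBall K r x' n' := by
  let F := frontier K
  have : Nonempty F := (nonempty_frontier_iff.2 ⟨hi.mono interior_subset, hne⟩).to_subtype
  have : CompleteSpace F := isClosed_frontier.completeSpace_coe
  let ρ : ℕ → ℝ := fun k => 1 / ((k : ℝ) + 1)
  have hρ : ∀ k, 0 < ρ k := fun k => by positivity
  let G : ℕ → Set F := fun k => (↑) ⁻¹' cthickening (ρ k) {c | closedBall c (ρ k) ⊆ K}
  have hball : ∀ k, ∀ x : F, x ∈ G k → ∀ n', IsOuterNormal K x n' → InnerBall K (ρ k) x n' := by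
    intro k x hx n' hn'
    have h1 : (x : Euc d) ∈ cthickening (ρ k) {c | closedBall c (ρ k) ⊆ K} := hx
    rw [(hcl.isClosed_setOf_closedBall_subset _).cthickening_eq_biUnion_closedBall
      (hρ k).le, mem_iUnion₂] at h1
    obtain ⟨c, hc, hxc⟩ := h1
    have h2 : dist (x : Euc d) c = ρ k := by
      refine le_antisymm hxc (not_lt.1 fun hlt => x.2.2 ?_)
      exact interior_mono hc (ball_subset_interior_closedBall hlt)
    have h3 := hn'.eq_of_ball (hρ k) h2 hc
    rw [InnerBall, ← h3, sub_sub_cancel]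
    exact hc
  obtain ⟨k, x, hx⟩ := nonempty_interior_of_iUnion_of_closed (f := G)
    (fun k => isClosed_cthickening.preimage continuous_subtype_val) (by
      refine eq_univ_of_forall fun x => ?_
      obtain ⟨n, hn⟩ := exists_isOuterNormal hK hcl hi x.2
      obtain ⟨r, hr, hb⟩ := hA.exists_ball hn
      obtain ⟨k, hk⟩ := exists_nat_one_div_lt hr
      refine mem_iUnion.2 ⟨k, ?_⟩
      refine mem_cthickening_of_dist_le (x : Euc d) (x - ρ k • n) _ _
        (hb.mono hn.2.1 hk.le) ?_
      rw [dist_eq_norm, sub_sub_cancel, norm_smul, hn.2.1, Real.norm_of_nonneg (hρ k).le, mul_one])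
  obtain ⟨δ, hδ, hsub⟩ := Metric.mem_nhds_iff.1 (mem_interior_iff_mem_nhds.1 hx)
  obtain ⟨n, hn⟩ := exists_isOuterNormal hK hcl hi x.2
  refine ⟨x, n, ρ k, hρ k, δ, hδ, hn, fun x' n' hn' hd => ?_⟩
  refine hball k ⟨x', hn'.mem_frontier⟩ (hsub ?_) n' hn'
  rw [mem_ball, Subtype.dist_eq, dist_eq_norm]
  exact hd

theorem rank_euc (hd : 2 ≤ d) : 1 < Module.rank ℝ (Euc d) := by
  rw [← Module.finrank_eq_rank, finrank_euclideanSpace_fin]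
  exact_mod_cast hd

theorem inner_sub_one_ge {v w : Euc d} (hv : ‖v‖ = 1) : 1 - ‖w - v‖ ≤ inner ℝ w v := by
  have h1 : inner ℝ w v = 1 + inner ℝ (w - v) v := by
    rw [inner_sub_left, real_inner_self_eq_norm_sq, hv]; ring
  have h2 := abs_real_inner_le_norm (w - v) v
  rw [hv, mul_one, abs_le] at h2
  linarith

/-- Nearby directions of a center of curvature lead to boundary points with the same center. -/
theorem CondA.isOuterNormal_of_near (hA : CondA K) (hK : Convex ℝ K) (hcl : IsClosed K)
    (hi : (interior K).Nonempty) {l : ℝ} (hl : 0 < l) {c v : Euc d}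
    (hv : IsOuterNormal K (c + l • v) v) (hs : LocallySpherical K (c + l • v) v l) :
    ∃ δ > 0, ∀ w : Euc d, ‖w‖ = 1 → ‖w - v‖ < δ → IsOuterNormal K (c + l • w) w := by
  obtain ⟨r, hr, hb⟩ := hA.exists_ball hv
  obtain ⟨δ, hδ, H⟩ := hs
  set η := min (min r l) (δ / 2) with hη
  have hη0 : 0 < η := by positivity
  have hηr : η ≤ r := (min_le_left _ _).trans (min_le_left _ _)
  have hηl : η ≤ l := (min_le_left _ _).trans (min_le_right _ _)
  have hηδ : η ≤ δ / 2 := min_le_right _ _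
  refine ⟨η / (l + η), by positivity, fun w hw hwv => ?_⟩
  rw [lt_div_iff₀ (by positivity)] at hwv
  have h0 := norm_nonneg (w - v)
  have ha : c + (l - η) • w ∈ K := by
    apply hb
    rw [mem_closedBall, dist_eq_norm, show c + (l - η) • w - (c + l • v - r • v)
      = (l - η) • (w - v) + (r - η) • v by module]
    refine (norm_add_le _ _).trans ?_
    rw [norm_smul, norm_smul, hv.2.1, Real.norm_of_nonneg (by linarith),
      Real.norm_of_nonneg (by linarith)]
    nlinarith
  have hb' : c + (l + η) • w ∉ K := by
    intro h
    have h1 := hv.2.2 _ h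
    rw [show c + (l + η) • w - (c + l • v) = (l + η) • w - l • v by abel, inner_sub_left,
      inner_smul_left, inner_smul_left, real_inner_self_eq_norm_sq, hv.2.1] at h1
    simp only [conj_trivial] at h1
    have h2 := inner_sub_one_ge (w := w) hv.2.1
    nlinarith
  obtain ⟨t, ⟨ht0, ht1⟩, ht⟩ := exists_mem_frontier_segment ha hb'
  obtain ⟨m, hm⟩ := exists_isOuterNormal hK hcl hi ht
  rw [show c + (l - η) • w + t • (c + (l + η) • w - (c + (l - η) • w))
    = c + (l - η + 2 * η * t) • w by module] at hm
  have hτ0 : 0 ≤ l - η + 2 * η * t := by nlinarith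
  have h3 := H _ _ hm (by
    rw [show c + (l - η + 2 * η * t) • w - (c + l • v)
      = l • (w - v) + (η * (2 * t - 1)) • w by module]
    refine (norm_add_le _ _).trans_lt ?_
    rw [norm_smul, norm_smul, hw, Real.norm_of_nonneg hl.le, Real.norm_eq_abs, abs_mul,
      abs_of_pos hη0]
    have : |2 * t - 1| ≤ 1 := abs_le.2 ⟨by linarith, by linarith⟩
    nlinarith)
  have h4 : (l - η + 2 * η * t) • w = l • m := by
    have : c + (l - η + 2 * η * t) • w - (c + l • v) = (l - η + 2 * η * t) • w - l • v := by abel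
    rw [this, smul_sub] at h3
    exact sub_left_injective h3
  have h5 : l - η + 2 * η * t = l := by
    have := congrArg norm h4
    rwa [norm_smul, norm_smul, hw, hm.2.1, Real.norm_of_nonneg hτ0, Real.norm_of_nonneg hl.le,
      mul_one, mul_one] at this
  rw [h5] at h4 hm
  obtain rfl : w = m := smul_right_injective _ hl.ne' h4
  exact hm

/-- A closed convex set whose boundary is locally a sphere of radius `l` is a ball. -/
theorem CondA.eq_closedBall (hA : CondA K) (hd : 2 ≤ d) (hK : Convex ℝ K) (hcl : IsClosed K)
    (hi : (interior K).Nonempty) (hne : K ≠ univ) {l : ℝ} (hl : 0 < l)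
    (hs : ∀ x n, IsOuterNormal K x n → LocallySpherical K x n l) :
    ∃ c, K = closedBall c l := by
  obtain ⟨x, hx⟩ := nonempty_frontier_iff.2 ⟨hi.mono interior_subset, hne⟩
  obtain ⟨n, hn⟩ := exists_isOuterNormal hK hcl hi hx
  set c := x - l • n with hc
  have hall : ∀ v : Euc d, ‖v‖ = 1 → IsOuterNormal K (c + l • v) v := by
    let T : Set (sphere (0 : Euc d) 1) := {v | IsOuterNormal K (c + l • (v : Euc d)) v}
    have : PreconnectedSpace (sphere (0 : Euc d) 1) :=
      isPreconnected_iff_preconnectedSpace.1 (isPreconnected_sphere (rank_euc hd) _ _)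
    have hcl' : IsClosed T := by
      have : T = {v : sphere (0 : Euc d) 1 | c + l • (v : Euc d) ∈ K} ∩
          ⋂ z ∈ K, {v : sphere (0 : Euc d) 1 |
            inner ℝ (z - (c + l • (v : Euc d))) (v : Euc d) ≤ 0} := by
        ext v
        simp [T, IsOuterNormal]
      rw [this]
      refine (hcl.preimage (by fun_prop)).inter (isClosed_biInter fun z _ => ?_)
      exact isClosed_le (by fun_prop) continuous_const
    have hop : IsOpen T := by
      refine Metric.isOpen_iff.2 fun v hv => ?_
      obtain ⟨δ, hδ, H⟩ := hA.isOuterNormal_of_near hK hcl hi hl hv (hs _ _ hv)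
      refine ⟨δ, hδ, fun w hw => H w (by simp) ?_⟩
      rwa [mem_ball, Subtype.dist_eq, dist_eq_norm] at hw
    have hT := IsClopen.eq_univ ⟨hcl', hop⟩
      ⟨⟨n, by simpa using hn.2.1⟩, by simpa [T, hc] using hn⟩
    intro v hv
    have : (⟨v, by simpa using hv⟩ : sphere (0 : Euc d) 1) ∈ T := hT ▸ mem_univ _
    exact this
  refine ⟨c, ?_⟩
  have hpolar : ∀ z : Euc d, ∃ v : Euc d, ‖v‖ = 1 ∧ z = c + ‖z - c‖ • v := by
    intro z
    by_cases h : z - c = 0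
    · exact ⟨n, hn.2.1, by rw [h]; simpa using sub_eq_zero.1 h⟩
    · refine ⟨‖z - c‖⁻¹ • (z - c), norm_smul_inv_norm h, ?_⟩
      rw [smul_smul, mul_inv_cancel₀ (norm_ne_zero_iff.2 h)]
      simp
  ext z
  rw [mem_closedBall, dist_eq_norm]
  obtain ⟨v, hv, hz⟩ := hpolar z
  have hs0 : 0 ≤ ‖z - c‖ := norm_nonneg _
  generalize ‖z - c‖ = s at hz hs0 ⊢
  subst hz
  constructor
  · intro h
    have h1 := (hall v hv).2.2 _ h
    rw [show c + s • v - (c + l • v) = (s - l) • v by module, inner_smul_left,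
      real_inner_self_eq_norm_sq, hv] at h1
    simp only [conj_trivial] at h1
    linarith
  · intro h
    have h1 := (hall v hv).1
    have h2 := (hall (-v) (by simpa using hv)).1
    have h3 := hK h1 h2 (a := (l + s) / (2 * l)) (b := (l - s) / (2 * l)) (by positivity)
      (div_nonneg (by linarith) (by linarith)) (by field_simp; ring)
    convert h3 using 1
    have h4 : (l + s) / (2 * l) + (l - s) / (2 * l) = 1 := by field_simp; ring
    have h5 : ((l + s) / (2 * l) - (l - s) / (2 * l)) * l = s := by field_simp; ring
    calc c + s • v = ((l + s) / (2 * l) + (l - s) / (2 * l)) • c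
        + (((l + s) / (2 * l) - (l - s) / (2 * l)) * l) • v := by rw [h4, h5, one_smul]
      _ = _ := by module

end LocalToGlobal

section Isometries

variable {d : ℕ}

/-- The determinant of a linear isometry. -/
abbrev isometryDet (S : Euc d ≃ₗᵢ[ℝ] Euc d) : ℝ :=
  LinearMap.det (S.toLinearEquiv : Euc d →ₗ[ℝ] Euc d)

theorem isometryDet_trans (S T : Euc d ≃ₗᵢ[ℝ] Euc d) :
    isometryDet (S.trans T) = isometryDet T * isometryDet S :=
  LinearMap.det_comp _ _

theorem isometryDet_refl : isometryDet (LinearIsometryEquiv.refl ℝ (Euc d)) = 1 :=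
  LinearMap.det_id

theorem isometryDet_neg : isometryDet (LinearIsometryEquiv.neg ℝ : Euc d ≃ₗᵢ[ℝ] Euc d)
    = (-1) ^ d := by
  have : ((LinearIsometryEquiv.neg ℝ : Euc d ≃ₗᵢ[ℝ] Euc d).toLinearEquiv : Euc d →ₗ[ℝ] Euc d)
      = (-1 : ℝ) • LinearMap.id := by
    ext; simp
  rw [isometryDet, this, LinearMap.det_smul, LinearMap.det_id, finrank_euclideanSpace_fin, mul_one]

theorem isometryDet_reflection {v : Euc d} (hv : v ≠ 0) :
    isometryDet (ℝ ∙ v)ᗮ.reflection = -1 := by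
  have := (ℝ ∙ v)ᗮ.det_reflection
  rw [Submodule.orthogonal_orthogonal, finrank_span_singleton hv, pow_one] at this
  exact this

theorem reflection_eq_self_of_inner_eq_zero {v z : Euc d} (h : inner ℝ v z = 0) :
    (ℝ ∙ v)ᗮ.reflection z = z :=
  Submodule.reflection_mem_subspace_eq_self (Submodule.mem_orthogonal_singleton_iff_inner_right.2 h)

theorem exists_ne_zero_orthogonal (W : Submodule ℝ (Euc d)) (hW : Module.finrank ℝ W < d) :
    ∃ v ≠ 0, ∀ w ∈ W, inner ℝ v w = 0 := by
  have : Wᗮ ≠ ⊥ := by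
    intro h
    rw [Submodule.orthogonal_eq_bot_iff] at h
    rw [h, finrank_top, finrank_euclideanSpace_fin] at hW
    exact lt_irrefl _ hW
  obtain ⟨v, hv, h0⟩ := Submodule.exists_mem_ne_zero_of_ne_bot this
  exact ⟨v, h0, fun w hw => Submodule.inner_left_of_mem_orthogonal hw hv⟩

theorem exists_unit_orthogonal (hd : 2 ≤ d) (n : Euc d) :
    ∃ f : Euc d, ‖f‖ = 1 ∧ inner ℝ f n = 0 := by
  obtain ⟨v, hv, h⟩ := exists_ne_zero_orthogonal (ℝ ∙ n) (by
    have := finrank_span_finset_le_card (R := ℝ) ({n} : Finset (Euc d))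
    rw [Finset.coe_singleton, Finset.card_singleton, Set.finrank] at this
    omega)
  refine ⟨‖v‖⁻¹ • v, norm_smul_inv_norm hv, ?_⟩
  rw [inner_smul_left, h n (Submodule.mem_span_singleton_self n), mul_zero]

theorem exists_isometry (hd : 2 ≤ d) {n u : Euc d} (hn : ‖n‖ = 1) (hu : ‖u‖ = 1) {s : ℝ}
    (hs : s = 1 ∨ s = -1) : ∃ S : Euc d ≃ₗᵢ[ℝ] Euc d, S n = u ∧ isometryDet S = s := by
  obtain ⟨S, hSn, hS⟩ : ∃ S : Euc d ≃ₗᵢ[ℝ] Euc d, S n = u ∧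
      (isometryDet S = 1 ∨ isometryDet S = -1) := by
    by_cases h : n - u = 0
    · exact ⟨LinearIsometryEquiv.refl ℝ _, sub_eq_zero.1 h, Or.inl isometryDet_refl⟩
    · exact ⟨_, Submodule.reflection_sub (hn.trans hu.symm), Or.inr (isometryDet_reflection h)⟩
  obtain ⟨f, hf, hfn⟩ := exists_unit_orthogonal hd n
  have hf0 : f ≠ 0 := fun h => by simp [h] at hf
  by_cases h : isometryDet S = s
  · exact ⟨S, hSn, h⟩
  · refine ⟨(ℝ ∙ f)ᗮ.reflection.trans S, ?_, ?_⟩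
    · rw [LinearIsometryEquiv.trans_apply, reflection_eq_self_of_inner_eq_zero hfn, hSn]
    · rw [isometryDet_trans, isometryDet_reflection hf0]
      rcases hS with h1 | h1 <;> rcases hs with h2 | h2
      · exact absurd (h1.trans h2.symm) h
      · rw [h1, h2]; norm_num
      · rw [h1, h2]; norm_num
      · exact absurd (h1.trans h2.symm) h

end Isometries

section SymmetricIntersections

variable {d : ℕ} {K L : Set (Euc d)}

/-- All intersections of directly congruent copies of `K` and `L` with nonempty interior are
centrally symmetric. -/
def SymmetricIntersections (K L : Set (Euc d)) : Prop :=
  ∀ φ ψ : Euc d ≃ᵃⁱ[ℝ] Euc d,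
    OrientationPreserving φ → OrientationPreserving ψ →
    (interior (φ '' K ∩ ψ '' L)).Nonempty → CentrallySymmetric (φ '' K ∩ ψ '' L)

theorem SymmetricIntersections.symm (H : SymmetricIntersections K L) :
    SymmetricIntersections L K := by
  intro φ ψ hφ hψ hi
  rw [inter_comm] at hi ⊢
  exact H ψ φ hψ hφ hi

/-- If `K` is exposed at `x`, then push `L` with its boundary point `y` into `K` at `x`. The
intersection has the center of its symmetry on the common normal, which forces `L` near `y` to be
congruent to `K` near `x`. -/
theorem SymmetricIntersections.locallyCongruent (H : SymmetricIntersections K L)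
    {x u y n : Euc d} {r : ℝ} (hr : 0 < r) (hx : IsOuterNormal K x u) (hxe : ExposedAt K x u)
    (hxb : InnerBall K r x u) (hy : IsOuterNormal L y n) (hyb : InnerBall L r y n)
    {S : Euc d ≃ₗᵢ[ℝ] Euc d} (hS : S n = u) (hdet : isometryDet S = (-1) ^ d) :
    LocallyCongruent L y K x S r := by
  let T : Euc d ≃ₗᵢ[ℝ] Euc d := S.trans (LinearIsometryEquiv.neg ℝ)
  let φ : Euc d ≃ᵃⁱ[ℝ] Euc d := AffineIsometryEquiv.constVAdd ℝ (Euc d) (r • u - x)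
  let ψ : Euc d ≃ᵃⁱ[ℝ] Euc d :=
    (AffineIsometryEquiv.constVAdd ℝ (Euc d) (-y)).trans T.toAffineIsometryEquiv
  have hφ : OrientationPreserving φ := isometryDet_refl
  have hψ : OrientationPreserving ψ := by
    change isometryDet T = 1
    rw [isometryDet_trans, isometryDet_neg, hdet, ← mul_pow]
    simp
  have hφapp : ∀ z, φ z = r • u - x + z := fun z => rfl
  have hψapp : ∀ z, ψ z = - S (-y + z) := fun z => rfl
  have hSu : S.symm u = n := by rw [← hS, S.symm_apply_apply]
  have hmem : ∀ w, w ∈ φ '' K ∩ ψ '' L ↔ x + w - r • u ∈ K ∧ y - S.symm w ∈ L := by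
    intro w
    refine and_congr ⟨?_, fun h => ⟨_, h, ?_⟩⟩ ⟨?_, fun h => ⟨_, h, ?_⟩⟩
    · rintro ⟨z, hz, rfl⟩
      rw [hφapp]
      convert hz using 1
      abel
    · rw [hφapp]; module
    · rintro ⟨z, hz, rfl⟩
      rw [hψapp]
      convert hz using 1
      simp
    · rw [hψapp]; simp
  have hKball : ∀ w : Euc d, ‖w‖ ≤ r → x + w - r • u ∈ K := by
    intro w hw
    apply hxb
    have h : x + w - r • u - (x - r • u) = w := by abel
    rwa [mem_closedBall, dist_eq_norm, h]
  have hLball : ∀ w : Euc d, ‖w - r • u‖ ≤ r → y - S.symm w ∈ L := by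
    intro w hw
    apply hyb
    rw [mem_closedBall, dist_eq_norm,
      show y - S.symm w - (y - r • n) = - S.symm (w - r • u) by
        rw [map_sub, map_smul, hSu]; abel, norm_neg, LinearIsometryEquiv.norm_map]
    exact hw
  have hru : ‖r • u‖ = r := by rw [norm_smul, hx.2.1, Real.norm_of_nonneg hr.le, mul_one]
  have hint : (interior (φ '' K ∩ ψ '' L)).Nonempty := by
    refine ⟨(2⁻¹ : ℝ) • r • u, mem_interior_iff_mem_nhds.2 ?_⟩
    refine Filter.mem_of_superset (ball_mem_nhds _ (half_pos hr)) fun w hw => ?_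
    rw [mem_ball, dist_eq_norm] at hw
    have h2 : ‖(2⁻¹ : ℝ) • r • u‖ = r / 2 := by rw [norm_smul, hru]; norm_num; ring
    refine (hmem w).2 ⟨hKball w ?_, hLball w ?_⟩
    · calc ‖w‖ = ‖(w - (2⁻¹ : ℝ) • r • u) + (2⁻¹ : ℝ) • r • u‖ := by rw [sub_add_cancel]
        _ ≤ _ := norm_add_le _ _
        _ ≤ r := by linarith
    · calc ‖w - r • u‖ = ‖(w - (2⁻¹ : ℝ) • r • u) - (2⁻¹ : ℝ) • r • u‖ := by congr 1; module
        _ ≤ _ := norm_sub_le _ _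
        _ ≤ r := by linarith
  obtain ⟨c, hc⟩ := H φ ψ hφ hψ hint
  have hrefl : ∀ w ∈ φ '' K ∩ ψ '' L, (2 : ℝ) • c - w ∈ φ '' K ∩ ψ '' L := fun w hw =>
    hc ▸ mem_image_of_mem _ hw
  have h0 : (0 : Euc d) ∈ φ '' K ∩ ψ '' L :=
    (hmem 0).2 ⟨hKball 0 (by simpa using hr.le), by simpa using hy.1⟩
  have h1 : r • u ∈ φ '' K ∩ ψ '' L :=
    (hmem _).2 ⟨by simpa using hx.1, hLball _ (by simpa using hr.le)⟩
  have h2c : (2 : ℝ) • c = r • u := by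
    have h2 := (hmem _).1 (hrefl _ h0)
    have h3 := (hmem _).1 (hrefl _ h1)
    rw [sub_zero] at h2
    have h4 := hx.2.2 _ h2.1
    have h5 := hy.2.2 _ h3.2
    have h6 : y - S.symm ((2 : ℝ) • c - r • u) - y = - S.symm ((2 : ℝ) • c - r • u) := by abel
    have h7 : x + (2 : ℝ) • c - r • u - x = (2 : ℝ) • c - r • u := by abel
    rw [h6, inner_neg_left, ← hSu, LinearIsometryEquiv.inner_map_map] at h5
    rw [h7] at h4
    have h8 := hxe _ h2.1 (by rw [h7]; linarith)
    rw [add_sub_assoc] at h8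
    exact sub_eq_zero.1 (by simpa using h8)
  rw [h2c] at hrefl
  intro z hz
  have hSz : ‖S z‖ ≤ r := by simpa using hz
  constructor
  · intro h
    have h2 := (hmem _).1 (hrefl (-S z)
      ((hmem _).2 ⟨hKball _ (by simpa using hz), by simpa using h⟩))
    convert h2.1 using 1
    abel
  · intro h
    have h2 := (hmem _).1 (hrefl (S z + r • u)
      ((hmem _).2 ⟨by convert h using 1; abel, hLball _ (by simpa using hz)⟩))
    convert h2.2 using 1
    simp

theorem SymmetricIntersections.locallyCongruent_rotation (H : SymmetricIntersections K L)
    (hd : 2 ≤ d) {x u y₁ n₁ y₂ n₂ : Euc d} {r : ℝ} (hr : 0 < r) (hx : IsOuterNormal K x u)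
    (hxe : ExposedAt K x u) (hxb : InnerBall K r x u)
    (h₁ : IsOuterNormal L y₁ n₁) (hb₁ : InnerBall L r y₁ n₁)
    (h₂ : IsOuterNormal L y₂ n₂) (hb₂ : InnerBall L r y₂ n₂)
    {R : Euc d ≃ₗᵢ[ℝ] Euc d} (hR : R n₁ = n₂) (hdet : isometryDet R = 1) :
    LocallyCongruent L y₁ L y₂ R r := by
  obtain ⟨S, hS, hSd⟩ := exists_isometry hd h₂.2.1 hx.2.1 (neg_one_pow_eq_or ℝ d)
  have hc₂ := H.locallyCongruent hr hx hxe hxb h₂ hb₂ hS hSd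
  have hc₁ := H.locallyCongruent hr hx hxe hxb h₁ hb₁ (S := R.trans S) (by simp [hR, hS])
    (by rw [isometryDet_trans, hSd, hdet, mul_one])
  intro z hz
  exact (hc₁ z hz).trans (hc₂ (R z) (by simpa using hz)).symm

theorem SymmetricIntersections.locallyCongruent_reflection (H : SymmetricIntersections K L)
    (hd : 3 ≤ d) {x u y₁ n₁ y₂ n₂ : Euc d} {r : ℝ} (hr : 0 < r) (hx : IsOuterNormal K x u)
    (hxe : ExposedAt K x u) (hxb : InnerBall K r x u)
    (h₁ : IsOuterNormal L y₁ n₁) (hb₁ : InnerBall L r y₁ n₁)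
    (h₂ : IsOuterNormal L y₂ n₂) (hb₂ : InnerBall L r y₂ n₂)
    {R : Euc d ≃ₗᵢ[ℝ] Euc d} (hR : R n₁ = n₂) (hdet : isometryDet R = -1) :
    LocallyCongruent L y₁ L y₂ R r := by
  intro z hz
  obtain ⟨v, hv, hvo⟩ := exists_ne_zero_orthogonal (Submodule.span ℝ {n₁, z})
    (by
      classical
      have h := finrank_span_finset_le_card (R := ℝ) ({n₁, z} : Finset (Euc d))
      rw [Finset.coe_pair, Set.finrank] at h
      have h2 : Finset.card {n₁, z} ≤ 2 := Finset.card_le_two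
      have h3 := h.trans h2
      omega)
  have hn := reflection_eq_self_of_inner_eq_zero (hvo n₁ (Submodule.subset_span (by simp)))
  have hz' := reflection_eq_self_of_inner_eq_zero (hvo z (Submodule.subset_span (by simp)))
  have := H.locallyCongruent_rotation (by omega) hr hx hxe hxb h₁ hb₁ h₂ hb₂
    (R := (ℝ ∙ v)ᗮ.reflection.trans R) (by simp [hn, hR])
    (by rw [isometryDet_trans, isometryDet_reflection hv, hdet]; norm_num) z hz
  rwa [LinearIsometryEquiv.trans_apply, hz'] at this

end SymmetricIntersections

section Spherical

variable {d : ℕ} {K : Set (Euc d)}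

theorem norm_add_smul_sub_smul_sub_le {f n : Euc d} {η s : ℝ} (x : Euc d) (hf : ‖f‖ = 1)
    (hn : ‖n‖ = 1) (hη : 0 ≤ η) (hs : 0 ≤ s) : ‖x + η • f - s • n - x‖ ≤ η + s := by
  have h : x + η • f - s • n - x = η • f - s • n := by abel
  rw [h]
  refine (norm_sub_le _ _).trans_eq ?_
  rw [norm_smul, norm_smul, hf, hn, Real.norm_of_nonneg hη, Real.norm_of_nonneg hs, mul_one,
    mul_one]

theorem exists_ne_near (hd : 2 ≤ d) (hK : Convex ℝ K) (hcl : IsClosed K)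
    (hi : (interior K).Nonempty) {x n : Euc d} {r δ : ℝ} (hn : IsOuterNormal K x n)
    (he : ExposedAt K x n) (hr : 0 < r) (hb : InnerBall K r x n) (hδ : 0 < δ) :
    ∃ y m, IsOuterNormal K y m ∧ ‖y - x‖ < δ ∧ y ≠ x := by
  obtain ⟨f, hf, hfn⟩ := exists_unit_orthogonal hd n
  have hη : 0 < min r (δ / 4) := by positivity
  set η := min r (δ / 4) with hηd
  have hηr : η ≤ r := min_le_left _ _
  have hηδ : η ≤ δ / 4 := min_le_right _ _
  obtain ⟨s, m, hs, hs', hm⟩ := exists_nearby_normal hK hcl hi hn he hb hf hfn hη hηr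
  have hsη : s ≤ η := by
    refine hs'.trans ?_
    rw [div_le_iff₀ hr]
    nlinarith
  refine ⟨_, m, hm,
    (norm_add_smul_sub_smul_sub_le x hf hn.2.1 hη.le hs).trans_lt (by linarith), fun h => ?_⟩
  · have h1 : η • f = s • n := by
      rw [← sub_eq_zero]
      calc _ = x + η • f - s • n - x := by abel
        _ = 0 := sub_eq_zero.2 h
    have h2 : inner ℝ f (η • f) = inner ℝ f (s • n) := by rw [h1]
    rw [inner_smul_right, inner_smul_right, hfn, real_inner_self_eq_norm_sq, hf] at h2
    linarith

theorem LocallySpherical.pos (hd : 2 ≤ d) (hK : Convex ℝ K) (hcl : IsClosed K)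
    (hi : (interior K).Nonempty) {x n : Euc d} {r l : ℝ} (hn : IsOuterNormal K x n)
    (he : ExposedAt K x n) (hr : 0 < r) (hb : InnerBall K r x n)
    (hs : LocallySpherical K x n l) : 0 < l := by
  obtain ⟨δ, hδ, h⟩ := hs
  obtain ⟨y, m, hm, hy, hyx⟩ := exists_ne_near hd hK hcl hi hn he hr hb hδ
  have h1 := h y m hm hy
  have h2 := hn.2.2 y hm.1
  have hmn : m ≠ n := by
    rintro rfl
    rw [sub_self, smul_zero] at h1
    exact hyx (sub_eq_zero.1 h1)
  have h3 := (inner_lt_one_iff_real_of_norm_eq_one hm.2.1 hn.2.1).2 hmn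
  rw [h1, inner_smul_left, inner_sub_left, real_inner_self_eq_norm_sq, hn.2.1] at h2
  have hl : l ≠ 0 := by
    rintro rfl
    rw [zero_smul] at h1
    exact hyx (sub_eq_zero.1 h1)
  refine lt_of_le_of_ne ?_ hl.symm
  simp only [conj_trivial] at h2
  nlinarith

/-- If all boundary points near an exposed point `x` are at the same distance from `c`, then `c`
lies on the normal at `x`. -/
theorem IsOuterNormal.sub_eq_smul_of_norm_eq (hK : Convex ℝ K) (hcl : IsClosed K)
    (hi : (interior K).Nonempty) {x n c : Euc d} {r δ : ℝ} (hn : IsOuterNormal K x n)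
    (he : ExposedAt K x n) (hr : 0 < r) (hb : InnerBall K r x n) (hδ : 0 < δ)
    (hc : ∀ y m, IsOuterNormal K y m → ‖y - x‖ < δ → ‖y - c‖ = ‖x - c‖) :
    x - c = inner ℝ (x - c) n • n := by
  set e := x - c with hed
  set a : ℝ := inner ℝ e n with had
  set g := e - a • n with hgd
  have hgn : inner ℝ g n = 0 := by
    rw [hgd, inner_sub_left, inner_smul_left, real_inner_self_eq_norm_sq, hn.2.1]
    simp [had]
  by_contra hne
  have hg : 0 < ‖g‖ := norm_pos_iff.2 (sub_ne_zero.2 hne)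
  set f := ‖g‖⁻¹ • g with hfd
  have hf : ‖f‖ = 1 := norm_smul_inv_norm (norm_pos_iff.1 hg)
  have hfn : inner ℝ f n = 0 := by rw [hfd, inner_smul_left, hgn, mul_zero]
  have hfe : inner ℝ e f = ‖g‖ := by
    have h1 : e = g + a • n := by rw [hgd]; abel
    rw [h1, inner_add_left, inner_smul_left, real_inner_comm, real_inner_comm f n, hfn, hfd,
      inner_smul_left, real_inner_self_eq_norm_sq]
    simp
    field_simp
  clear_value f
  set η := min (min r (δ / 4)) (‖g‖ * r / (2 * (|a| + 1))) with hηd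
  have hη : 0 < η := by positivity
  have hηr : η ≤ r := (min_le_left _ _).trans (min_le_left _ _)
  have hηδ : η ≤ δ / 4 := (min_le_left _ _).trans (min_le_right _ _)
  have hηg : η * (2 * (|a| + 1)) ≤ ‖g‖ * r :=
    (le_div_iff₀ (by positivity)).1 (min_le_right _ _)
  obtain ⟨s, m, hs, hs', hm⟩ := exists_nearby_normal hK hcl hi hn he hb hf hfn hη hηr
  have hsr : s * r ≤ η ^ 2 := (le_div_iff₀ hr).1 hs'
  have hsη : s ≤ η := by
    refine hs'.trans ?_
    rw [div_le_iff₀ hr]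
    nlinarith
  have hnear : ‖x + η • f - s • n - x‖ < δ :=
    (norm_add_smul_sub_smul_sub_le x hf hn.2.1 hη.le hs).trans_lt (by linarith)
  have h1 := hc _ m hm hnear
  have h2 : x + η • f - s • n - c = e + (η • f + (-s) • n) := by rw [hed]; module
  have h3 : ‖x + η • f - s • n - c‖ ^ 2 = ‖e‖ ^ 2 := by rw [h1]
  rw [h2, norm_add_sq_real, norm_sq_smul_add_smul hn.2.1 hf hfn, inner_add_right,
    inner_smul_right, inner_smul_right, hfe, ← had] at h3
  have h4 : 2 * η * ‖g‖ ≤ 2 * s * |a| := by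
    nlinarith [le_abs_self a, sq_nonneg η, sq_nonneg s, mul_le_mul_of_nonneg_left (le_abs_self a) hs]
  have h5 : 2 * η * (‖g‖ * r) ≤ 2 * η * (η * |a|) := by
    calc _ = (2 * η * ‖g‖) * r := by ring
      _ ≤ (2 * s * |a|) * r := by gcongr
      _ = 2 * |a| * (s * r) := by ring
      _ ≤ 2 * |a| * η ^ 2 := by gcongr
      _ = _ := by ring
  have h6 := le_of_mul_le_mul_left h5 (by positivity)
  nlinarith [abs_nonneg a, mul_nonneg hη.le (abs_nonneg a)]

theorem sub_ne_smul_sub_of_norm_one {a b c : Euc d} (ha : ‖a‖ = 1) (hb : ‖b‖ = 1) (hc : ‖c‖ = 1)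
    (hab : a ≠ b) (hbc : b ≠ c) (hac : a ≠ c) (t : ℝ) : b - a ≠ t • (c - a) := by
  intro h
  have h1 : b = a + t • (c - a) := by rw [← h]; abel
  have h2 : ‖b‖ ^ 2 = ‖a + t • (c - a)‖ ^ 2 := by rw [← h1]
  have h3 : ‖a - c‖ ^ 2 = ‖a‖ ^ 2 - 2 * inner ℝ a c + ‖c‖ ^ 2 := norm_sub_sq_real _ _
  have h4 := (inner_lt_one_iff_real_of_norm_eq_one ha hc).2 hac
  rw [norm_add_sq_real, inner_smul_right, inner_sub_right, norm_smul, mul_pow, norm_sub_rev, h3,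
    real_inner_self_eq_norm_sq, ha, hb, hc, Real.norm_eq_abs, sq_abs] at h2
  have h5 : t * (t - 1) = 0 := by
    have : (t * (t - 1)) * (2 * (1 - inner ℝ a c)) = 0 := by linarith
    rcases mul_eq_zero.1 this with h | h
    · exact h
    · linarith
  rcases mul_eq_zero.1 h5 with h6 | h6
  · rw [h6, zero_smul, sub_eq_zero] at h
    exact hab h.symm
  · rw [sub_eq_zero.1 h6, one_smul] at h
    exact hbc (sub_left_inj.1 h)

/-- Near any two boundary points close to `y`, the set `K` looks the same under every isometry of
determinant `s` which matches the normals. -/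
def LocallyHomogeneous (K : Set (Euc d)) (s : ℝ) (y : Euc d) (r : ℝ) : Prop :=
  ∀ y₁ n₁ y₂ n₂, IsOuterNormal K y₁ n₁ → IsOuterNormal K y₂ n₂ → ‖y₁ - y‖ < r / 2 →
    ‖y₂ - y‖ < r / 2 → ∀ R : Euc d ≃ₗᵢ[ℝ] Euc d, R n₁ = n₂ → isometryDet R = s →
      LocallyCongruent K y₁ K y₂ R r

theorem LocallyHomogeneous.exists_locallySpherical_of_reflection (hd : 2 ≤ d)
    (hK : Convex ℝ K) (hcl : IsClosed K)
    (hi : (interior K).Nonempty) {y n : Euc d} {r : ℝ} (hn : IsOuterNormal K y n)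
    (he : ∀ x m, IsOuterNormal K x m → ExposedAt K x m) (hr : 0 < r) (hb : InnerBall K r y n)
    (H : LocallyHomogeneous K (-1) y r) : ∃ l, LocallySpherical K y n l := by
  have key : ∀ y₁ n₁ y₂ n₂, IsOuterNormal K y₁ n₁ → IsOuterNormal K y₂ n₂ → ‖y₁ - y‖ < r / 2 →
      ‖y₂ - y‖ < r / 2 → ∃ l : ℝ, y₂ - y₁ = l • (n₂ - n₁) := by
    intro y₁ n₁ y₂ n₂ h₁ h₂ hy₁ hy₂
    by_cases h12 : n₁ = n₂
    · subst h12
      exact ⟨0, by rw [(he _ _ h₁).eq_of_normal h₁ h₂]; simp⟩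
    have hF := Submodule.reflection_sub (h₁.2.1.trans h₂.2.1.symm)
    have hF' : (ℝ ∙ (n₁ - n₂))ᗮ.reflection n₂ = n₁ := by
      rw [← Submodule.reflection_symm, LinearIsometryEquiv.symm_apply_eq, hF]
    have hw : ‖y₂ - y₁‖ < r := by
      calc _ = ‖(y₂ - y) - (y₁ - y)‖ := by congr 1; abel
        _ ≤ _ := norm_sub_le _ _
        _ < r := by linarith
    have h3 := (H _ _ _ _ h₁ h₂ hy₁ hy₂ _ hF (isometryDet_reflection (sub_ne_zero.2 h12)))
    have h4 := IsOuterNormal.map (m := n₂) hK h3 hw (by simpa using h₂)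
    rw [hF'] at h4
    have h5 := (he _ _ h₁).eq_of_normal h₁ h4
    have h6 : (ℝ ∙ (n₁ - n₂))ᗮ.reflection (y₂ - y₁) = -(y₂ - y₁) := by
      rw [← sub_eq_zero, ← sub_eq_zero.2 h5]; abel
    rw [Submodule.reflection_orthogonal_apply, neg_inj, Submodule.reflection_eq_self_iff,
      Submodule.mem_span_singleton] at h6
    obtain ⟨l, hl⟩ := h6
    exact ⟨-l, by rw [← hl]; module⟩
  obtain ⟨y₁, n₁, h₁, hy₁, hne⟩ := exists_ne_near hd hK hcl hi hn (he _ _ hn) hr hb (half_pos hr)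
  have hy : ‖y - y‖ < r / 2 := by simpa using hr
  obtain ⟨l, hl⟩ := key y n y₁ n₁ hn h₁ hy hy₁
  refine ⟨l, r / 2, half_pos hr, fun y₂ n₂ h₂ hy₂ => ?_⟩
  obtain ⟨a, ha⟩ := key y n y₂ n₂ hn h₂ hy hy₂
  obtain ⟨b, hb'⟩ := key y₁ n₁ y₂ n₂ h₁ h₂ hy₁ hy₂
  have hn01 : n ≠ n₁ := by
    rintro rfl
    exact hne ((he _ _ hn).eq_of_normal hn h₁)
  by_cases hn02 : n = n₂
  · subst hn02
    rw [ha]; simp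
  by_cases hn12 : n₁ = n₂
  · subst hn12
    rw [(he _ _ h₁).eq_of_normal h₁ h₂, hl]
  by_cases hab : b = a
  · subst hab
    have h3 : (b - l) • (n₁ - n) = 0 := by
      have : y₁ - y = (y₂ - y) - (y₂ - y₁) := by abel
      rw [hl, ha, hb'] at this
      rw [sub_smul, this]; module
    rcases smul_eq_zero.1 h3 with h4 | h4
    · rw [ha, sub_eq_zero.1 h4]
    · exact absurd (sub_eq_zero.1 h4).symm hn01
  · exfalso
    have h3 : (l - b) • (n₁ - n) = (a - b) • (n₂ - n) := by
      have : y₁ - y = (y₂ - y) - (y₂ - y₁) := by abel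
      rw [hl, ha, hb'] at this
      rw [sub_smul, this]; module
    have hlb : l - b ≠ 0 := by
      intro h
      rw [h, zero_smul, eq_comm, smul_eq_zero, sub_eq_zero, sub_eq_zero] at h3
      rcases h3 with h | h
      · exact hab h.symm
      · exact hn02 h.symm
    refine sub_ne_smul_sub_of_norm_one hn.2.1 h₁.2.1 h₂.2.1 hn01 hn12 hn02 ((l - b)⁻¹ * (a - b)) ?_
    rw [mul_smul, ← h3, inv_smul_smul₀ hlb]

end Spherical

section Plane

theorem LocallyHomogeneous.exists_locallySpherical_of_rotation {K : Set (Euc 2)}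
    (hK : Convex ℝ K) (hcl : IsClosed K)
    (hi : (interior K).Nonempty) {y n : Euc 2} {r : ℝ} (hn : IsOuterNormal K y n)
    (he : ∀ x m, IsOuterNormal K x m → ExposedAt K x m) (hr : 0 < r) (hb : InnerBall K r y n)
    (H : LocallyHomogeneous K 1 y r) : ∃ l, LocallySpherical K y n l := by
  have : Fact (Module.finrank ℝ (Euc 2) = 2) := ⟨finrank_euclideanSpace_fin⟩
  let o : Orientation ℝ (Euc 2) (Fin 2) := (EuclideanSpace.basisFun (Fin 2) ℝ).toBasis.orientation
  let R : Euc 2 → (Euc 2 ≃ₗᵢ[ℝ] Euc 2) := fun m => o.rotation (o.oangle n m)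
  have hR : ∀ m, ‖m‖ = 1 → R m n = m := fun m hm =>
    (o.rotation_oangle_eq_iff_norm_eq n m).2 (hn.2.1.trans hm.symm)
  have hdet : ∀ m, isometryDet (R m) = 1 := fun m => o.det_rotation _
  have hcomm : ∀ m m' z, R m (R m' z) = R m' (R m z) := fun m m' z => by
    simp only [R, o.rotation_rotation, add_comm]
  have hyy : ‖y - y‖ < r / 2 := by simpa using hr
  have key : ∀ y₁ n₁ y₂ n₂, IsOuterNormal K y₁ n₁ → IsOuterNormal K y₂ n₂ → ‖y₁ - y‖ < r / 2 →
      ‖y₂ - y‖ < r / 2 →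
      (y₁ - y) - R n₂ (y₁ - y) = (y₂ - y) - R n₁ (y₂ - y) := by
    intro y₁ n₁ y₂ n₂ h₁ h₂ hy₁ hy₂
    have h3 : IsOuterNormal K (y₁ + R n₁ (y₂ - y)) (R n₁ n₂) :=
      IsOuterNormal.map hK (H _ _ _ _ hn h₁ hyy hy₁ _ (hR _ h₁.2.1) (hdet _))
        (hy₂.trans (half_lt_self hr)) (by simpa using h₂)
    have h4 : IsOuterNormal K (y₂ + R n₂ (y₁ - y)) (R n₂ n₁) :=
      IsOuterNormal.map hK (H _ _ _ _ hn h₂ hyy hy₂ _ (hR _ h₂.2.1) (hdet _))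
        (hy₁.trans (half_lt_self hr)) (by simpa using h₁)
    have h5 : R n₁ n₂ = R n₂ n₁ := by
      calc _ = R n₁ (R n₂ n) := by rw [hR n₂ h₂.2.1]
        _ = R n₂ (R n₁ n) := hcomm _ _ _
        _ = _ := by rw [hR n₁ h₁.2.1]
    rw [h5] at h3
    have h6 := (he _ _ h3).eq_of_normal h3 h4
    rw [← sub_eq_zero, ← sub_eq_zero.2 h6.symm]
    abel
  obtain ⟨y₁, n₁, h₁, hy₁, hne⟩ :=
    exists_ne_near le_rfl hK hcl hi hn (he _ _ hn) hr hb (half_pos hr)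
  have hne' : n₁ ≠ n := by
    rintro rfl
    exact hne ((he _ _ hn).eq_of_normal hn h₁)
  have hn0 : n ≠ 0 := fun h => by simpa [h] using hn.2.1
  let A : Euc 2 →ₗ[ℝ] Euc 2 := LinearMap.id - ((R n₁).toLinearEquiv : Euc 2 →ₗ[ℝ] Euc 2)
  have hA : ∀ z, A z = z - R n₁ z := fun z => rfl
  have hinj : Function.Injective A := by
    refine (injective_iff_map_eq_zero A).2 fun z hz => ?_
    by_contra h0
    have h2 : o.oangle n n₁ = 0 :=
      (o.rotation_eq_self_iff_angle_eq_zero h0 _).1 (sub_eq_zero.1 hz).symm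
    have h3 : R n₁ n = n := by simp only [R, h2, o.rotation_zero]; rfl
    exact hne' ((hR n₁ h₁.2.1).symm.trans h3)
  obtain ⟨p, hp⟩ := LinearMap.injective_iff_surjective.1 hinj (y₁ - y)
  have hcenter : ∀ y₂ n₂, IsOuterNormal K y₂ n₂ → ‖y₂ - y‖ < r / 2 → y₂ - y = p - R n₂ p := by
    intro y₂ n₂ h₂ hy₂
    apply hinj
    rw [hA, key y₂ n₂ y₁ n₁ h₂ h₁ hy₂ hy₁, ← hp, hA, hA, map_sub, map_sub, hcomm n₂ n₁]
    abel
  have hc := hn.sub_eq_smul_of_norm_eq (c := y + p) hK hcl hi (he _ _ hn) hr hb (half_pos hr)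
    fun y₂ n₂ h₂ hy₂ => by
      have h3 : y₂ - (y + p) = - R n₂ p := by
        rw [← sub_sub, hcenter y₂ n₂ h₂ hy₂]; abel
      rw [h3, norm_neg, LinearIsometryEquiv.norm_map, sub_add_cancel_left, norm_neg]
  set a := inner ℝ (y - (y + p)) n
  have hpa : p = (-a) • n := by
    rw [neg_smul, ← hc]; abel
  refine ⟨a, r / 2, half_pos hr, fun y₂ n₂ h₂ hy₂ => ?_⟩
  rw [hcenter y₂ n₂ h₂ hy₂, hpa, map_smul, hR n₂ h₂.2.1]
  module

end Plane

section Balls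

variable {d : ℕ} {K L : Set (Euc d)}

theorem exists_isOuterNormal_exposedAt (hd : 2 ≤ d) (hK : Convex ℝ K) (hcl : IsClosed K)
    (hi : (interior K).Nonempty) (he : HasExtremePoint K) :
    ∃ x u, IsOuterNormal K x u ∧ ExposedAt K x u := by
  obtain ⟨x, hx, hxe⟩ := he
  refine exists_exposedAt hK hcl (x := x) ⟨hx, fun y hy z hz h => ?_⟩ ?_
  · by_cases hyz : y = z
    · subst hyz
      simpa [eq_comm] using h
    · exact absurd h (hxe y hy z hz hyz)
  · rintro rfl
    have : Nontrivial (Euc d) :=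
      Module.nontrivial_of_finrank_pos (R := ℝ) (by rw [finrank_euclideanSpace_fin]; omega)
    rw [interior_singleton] at hi
    exact hi.ne_empty rfl

/-- If `K` has an extreme point, then both bodies are balls of the same radius. -/
theorem SymmetricIntersections.exists_eq_closedBall (H : SymmetricIntersections K L) (hd : 2 ≤ d)
    (hKcl : IsClosed K) (hK : Convex ℝ K) (hKi : (interior K).Nonempty) (hKne : K ≠ univ)
    (hLcl : IsClosed L) (hL : Convex ℝ L) (hLi : (interior L).Nonempty) (hLne : L ≠ univ)
    (hKA : CondA K) (hLA : CondA L) (he : HasExtremePoint K) :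
    ∃ r : ℝ, 0 < r ∧ ∃ c c' : Euc d, K = closedBall c r ∧ L = closedBall c' r := by
  obtain ⟨x, u, hx, hxe⟩ := exists_isOuterNormal_exposedAt hd hK hKcl hKi he
  obtain ⟨ρ, hρ, hxb⟩ := hKA.exists_ball hx
  have hlens : ∀ y n, IsOuterNormal L y n →
      ∃ S : Euc d ≃ₗᵢ[ℝ] Euc d, S n = u ∧ ∃ r > 0, LocallyCongruent L y K x S r := by
    intro y n hy
    obtain ⟨σ, hσ, hyb⟩ := hLA.exists_ball hy
    obtain ⟨S, hS, hdet⟩ := exists_isometry hd hy.2.1 hx.2.1 (neg_one_pow_eq_or ℝ d)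
    exact ⟨S, hS, min ρ σ, lt_min hρ hσ, H.locallyCongruent (lt_min hρ hσ) hx hxe
      (hxb.mono hx.2.1 (min_le_left _ _)) hy (hyb.mono hy.2.1 (min_le_right _ _)) hS hdet⟩
  have hLe : ∀ y n, IsOuterNormal L y n → ExposedAt L y n := by
    intro y n hy
    obtain ⟨S, hS, r, hr, hc⟩ := hlens y n hy
    have := hxe.map hr hL hc.symm hx.1
    rwa [← hS, S.symm_apply_apply] at this
  obtain ⟨y, n, r₀, hr₀, δ, hδ, hy, hpatch⟩ := hLA.exists_uniform_patch hL hLcl hLi hLne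
  set r := min (min ρ r₀) δ with hrd
  have hr : 0 < r := lt_min (lt_min hρ hr₀) hδ
  have hball : ∀ y' n', IsOuterNormal L y' n' → ‖y' - y‖ < r / 2 → InnerBall L r y' n' := by
    intro y' n' h' hy'
    have h2 : r ≤ δ := min_le_right _ _
    exact (hpatch y' n' h' (by linarith)).mono h'.2.1
      ((min_le_left _ _).trans (min_le_right _ _))
  have hxb' : InnerBall K r x u := hxb.mono hx.2.1 ((min_le_left _ _).trans (min_le_left _ _))
  have hyb : InnerBall L r y n := hball y n hy (by simpa using hr)
  obtain ⟨l, hl⟩ : ∃ l, LocallySpherical L y n l := by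
    rcases hd.eq_or_lt with h2 | h3
    · subst h2
      refine LocallyHomogeneous.exists_locallySpherical_of_rotation hL hLcl hLi hy hLe hr hyb ?_
      intro y₁ n₁ y₂ n₂ h₁ h₂ hy₁ hy₂ R hR hdet
      exact H.locallyCongruent_rotation hd hr hx hxe hxb' h₁ (hball _ _ h₁ hy₁) h₂
        (hball _ _ h₂ hy₂) hR hdet
    · refine LocallyHomogeneous.exists_locallySpherical_of_reflection hd hL hLcl hLi hy hLe hr
        hyb ?_
      intro y₁ n₁ y₂ n₂ h₁ h₂ hy₁ hy₂ R hR hdet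
      exact H.locallyCongruent_reflection h3 hr hx hxe hxb' h₁ (hball _ _ h₁ hy₁) h₂
        (hball _ _ h₂ hy₂) hR hdet
  have hlpos := hl.pos hd hL hLcl hLi hy (hLe _ _ hy) hr hyb
  have hxl : LocallySpherical K x u l := by
    obtain ⟨S, hS, s, hs, hc⟩ := hlens y n hy
    exact hS ▸ hl.map hs hL hc
  have hLl : ∀ y' n', IsOuterNormal L y' n' → LocallySpherical L y' n' l := by
    intro y' n' hy'
    obtain ⟨S, hS, s, hs, hc⟩ := hlens y' n' hy'
    have := hxl.map hs hK hc.symm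
    rwa [← hS, S.symm_apply_apply] at this
  have hKl : ∀ x' n', IsOuterNormal K x' n' → LocallySpherical K x' n' l := by
    intro x' n' hx'
    obtain ⟨σ, hσ, hxb''⟩ := hKA.exists_ball hx'
    obtain ⟨S, hS, hdet⟩ := exists_isometry hd hx'.2.1 hy.2.1 (neg_one_pow_eq_or ℝ d)
    have hm : 0 < min r σ := lt_min hr hσ
    have hc := H.symm.locallyCongruent hm hy (hLe _ _ hy) (hyb.mono hy.2.1 (min_le_left _ _)) hx'
      (hxb''.mono hx'.2.1 (min_le_right _ _)) hS hdet
    have := hl.map hm hL hc.symm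
    rwa [← hS, S.symm_apply_apply] at this
  obtain ⟨c, hc⟩ := hKA.eq_closedBall hd hK hKcl hKi hKne hlpos hKl
  obtain ⟨c', hc'⟩ := hLA.eq_closedBall hd hL hLcl hLi hLne hlpos hLl
  exact ⟨l, hlpos, c, c', hc, hc'⟩

theorem centrallySymmetric_closedBall_inter_closedBall (a b : Euc d) (r : ℝ) :
    CentrallySymmetric (closedBall a r ∩ closedBall b r) := by
  have h2 : (2 : ℝ) • ((2⁻¹ : ℝ) • (a + b)) = a + b := by module
  have hsub : ∀ x ∈ closedBall a r ∩ closedBall b r,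
      a + b - x ∈ closedBall a r ∩ closedBall b r := by
    intro x ⟨ha, hb⟩
    rw [mem_closedBall_iff_norm'] at ha hb
    refine ⟨mem_closedBall_iff_norm.2 ?_, mem_closedBall_iff_norm.2 ?_⟩
    · rwa [add_sub_assoc, add_sub_cancel_left]
    · rwa [add_comm a b, add_sub_assoc, add_sub_cancel_left]
  refine ⟨(2⁻¹ : ℝ) • (a + b), ?_⟩
  simp only [h2]
  refine Subset.antisymm (image_subset_iff.2 hsub) fun x hx => ⟨_, hsub x hx, ?_⟩
  exact sub_sub_cancel _ _

end Balls

/-- Theorem 2 (Euclidean case): all intersections with nonempty interior of congruent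
copies are centrally symmetric iff `K` and `L` are congruent balls. -/
theorem intersections_centrally_symmetric_iff_congruent_balls
    (d : ℕ) (hd : 2 ≤ d) (K L : Set (Euc d))
    (hKcl : IsClosed K) (hKconv : Convex ℝ K) (hKint : (interior K).Nonempty)
    (hKne : K ≠ univ)
    (hLcl : IsClosed L) (hLconv : Convex ℝ L) (hLint : (interior L).Nonempty)
    (hLne : L ≠ univ)
    (hKA : CondA K) (hLA : CondA L)
    (hext : HasExtremePoint K ∨ HasExtremePoint L) :
    (∀ φ ψ : Euc d ≃ᵃⁱ[ℝ] Euc d,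
        OrientationPreserving φ → OrientationPreserving ψ →
        (interior (φ '' K ∩ ψ '' L)).Nonempty →
        CentrallySymmetric (φ '' K ∩ ψ '' L)) ↔
    (∃ r : ℝ, 0 < r ∧ ∃ c c' : Euc d, K = closedBall c r ∧ L = closedBall c' r) := by
  constructor
  · intro H
    rcases hext with he | he
    · exact SymmetricIntersections.exists_eq_closedBall H hd hKcl hKconv hKint hKne hLcl hLconv
        hLint hLne hKA hLA he
    · obtain ⟨r, hr, c, c', hL, hK⟩ := SymmetricIntersections.exists_eq_closedBall
        (SymmetricIntersections.symm H) hd hLcl hLconv hLint hLne hKcl hKconv hKint hKne hLA hKA he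
      exact ⟨r, hr, c', c, hK, hL⟩
  · rintro ⟨r, -, c, c', rfl, rfl⟩ φ ψ - - -
    have h : ∀ (χ : Euc d ≃ᵃⁱ[ℝ] Euc d) (z : Euc d),
        χ '' closedBall z r = closedBall (χ z) r :=
      fun χ z => χ.toIsometryEquiv.image_closedBall z r
    rw [h, h]
    exact centrallySymmetric_closedBall_inter_closedBall _ _ _
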